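/- arXiv:2303.12693 — 5 statements merged into one kernel-verified Lean document; each statement's English description precedes it below -/
import Mathlib

section
/- Let F ∈ ℝ^{n×n} be Hurwitz (every eigenvalue of F, viewed as a complex matrix, has strictly negative real part), let ε > 0, and let F₁ : [t₀,∞) → ℝ^{n×n} and F₂ : [t₀,∞) → ℝ^n be continuous and bounded with F₁(t) → 0 and F₂(t) → 0 as t → ∞. If x : [t₀,∞) → ℝ^n is differentiable and satisfies ẋ(t) = ε F x(t) + F₁(t) x(t) + F₂(t) for all t ≥ t₀, then x(t) → 0 as t → ∞, for every initial value x(t₀). -/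
open Matrix Filter

section PerturbationLemma

open Set Topology
open scoped Pointwise

/-- If the spectrum of `a` lies in the open left half-plane, then the explicit Euler step `1 + h a`
has spectral radius less than one for some step size `h > 0`. -/
theorem exists_spectralRadius_one_add_smul_lt_one {A : Type*} [NormedRing A] [NormedAlgebra ℂ A]
    [CompleteSpace A] [Nontrivial A] (a : A) (ha : ∀ μ ∈ spectrum ℂ a, μ.re < 0) :
    ∃ h : ℝ, 0 < h ∧ spectralRadius ℂ (1 + (h : ℂ) • a) < 1 := by
  obtain ⟨μ₀, hμ₀, hmax⟩ := (spectrum.isCompact (𝕜 := ℂ) a).exists_isMaxOn (spectrum.nonempty a)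
    Complex.continuous_re.continuousOn
  obtain ⟨M, hM, hbd⟩ := (spectrum.isCompact (𝕜 := ℂ) a).isBounded.exists_pos_norm_le
  have hc : 0 < -μ₀.re := neg_pos.2 (ha μ₀ hμ₀)
  set c := -μ₀.re with hcdef
  refine ⟨c / M ^ 2, by positivity, ?_⟩
  set h := c / M ^ 2 with hh
  have hpos : 0 < h := by positivity
  refine mod_cast spectrum.spectralRadius_lt_of_forall_lt (r := 1) _ fun z hz => ?_
  have hz' : z ∈ ({1} : Set ℂ) + (h : ℂ) • spectrum ℂ a := by
    rw [← spectrum.smul_eq_smul _ _ (spectrum.nonempty a), spectrum.singleton_add_eq]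
    simpa using hz
  obtain ⟨_, rfl, _, ⟨μ, hμ, rfl⟩, rfl⟩ := hz'
  have hre : μ.re ≤ -c := by simpa [hcdef] using hmax hμ
  have hnorm : μ.re * μ.re + μ.im * μ.im ≤ M ^ 2 := by
    have := pow_le_pow_left₀ (norm_nonneg μ) (hbd μ hμ) 2
    rwa [← Complex.normSq_eq_norm_sq, Complex.normSq_apply] at this
  have hM2 : h * M ^ 2 = c := by rw [hh]; field_simp
  have hsq : ‖1 + (h : ℂ) * μ‖ ^ 2 < 1 := by
    rw [← Complex.normSq_eq_norm_sq, Complex.normSq_apply]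
    simp only [Complex.add_re, Complex.add_im, Complex.one_re, Complex.one_im, Complex.re_ofReal_mul,
      Complex.im_ofReal_mul, zero_add]
    nlinarith [mul_le_mul_of_nonneg_left hnorm (mul_pos hpos hpos).le,
      mul_le_mul_of_nonneg_left hre hpos.le, mul_pos hpos hc]
  rw [← NNReal.coe_lt_coe]
  simpa using (sq_lt_one_iff₀ (norm_nonneg _)).1 hsq

theorem exists_norm_pow_le_pow_of_spectralRadius_lt_one {A : Type*} [NormedRing A]
    [NormedAlgebra ℂ A] [CompleteSpace A] (a : A) (ha : spectralRadius ℂ a < 1) :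
    ∃ r : ℝ, 0 < r ∧ r < 1 ∧ ∃ m : ℕ, 0 < m ∧ ‖a ^ m‖ ≤ r ^ m := by
  obtain ⟨r, har, hr1⟩ := ENNReal.lt_iff_exists_nnreal_btwn.1 ha
  obtain ⟨m, hm, hm0⟩ := (((spectrum.pow_nnnorm_pow_one_div_tendsto_nhds_spectralRadius
    a).eventually_lt_const har).and (eventually_gt_atTop 0)).exists
  have hm0' : (m : ℝ) ≠ 0 := by positivity
  refine ⟨r, ?_, mod_cast hr1, m, hm0, ?_⟩
  · exact NNReal.coe_pos.2 (ENNReal.coe_pos.1 (bot_le.trans_lt har))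
  · have := ENNReal.rpow_le_rpow hm.le (Nat.cast_nonneg (α := ℝ) m)
    rw [← ENNReal.rpow_mul, one_div_mul_cancel hm0', ENNReal.rpow_one, ENNReal.rpow_natCast] at this
    exact_mod_cast this

/-- If `‖B ^ m‖ ≤ r ^ m`, then `B` contracts by the factor `r` in some equivalent norm. -/
theorem exists_seminorm_contracting {E : Type*} [NormedAddCommGroup E] [NormedSpace ℝ E]
    (B : E →L[ℝ] E) {r : ℝ} (hr : 0 < r) {m : ℕ} (hm : 0 < m) (hB : ‖B ^ m‖ ≤ r ^ m) :
    ∃ p : Seminorm ℝ E, (∀ x, ‖x‖ ≤ p x) ∧ (∃ C, 0 < C ∧ ∀ x, p x ≤ C * ‖x‖) ∧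
      ∀ x, p (B x) ≤ r * p x := by
  set D : E →L[ℝ] E := r⁻¹ • B with hD
  have hDm : ‖D ^ m‖ ≤ 1 := by
    rw [hD, smul_pow, norm_smul, norm_pow, norm_inv, Real.norm_of_nonneg hr.le, inv_pow]
    exact (inv_mul_le_one₀ (by positivity)).2 hB
  let p : Seminorm ℝ E := ∑ k ∈ Finset.range m,
    (normSeminorm ℝ E).comp ((D ^ k : E →L[ℝ] E) : E →ₗ[ℝ] E)
  have hp : ∀ x, p x = ∑ k ∈ Finset.range m, ‖(D ^ k) x‖ := fun x => by
    simp only [p, FunLike.coe_sum, Finset.sum_apply]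
    rfl
  have hpD : ∀ x, p (D x) ≤ p x := fun x => by
    have h1 : ∑ k ∈ Finset.range m, ‖(D ^ k) (D x)‖ + ‖x‖ = p x + ‖(D ^ m) x‖ := by
      rw [hp, ← Finset.sum_range_succ (fun k => ‖(D ^ k) x‖), Finset.sum_range_succ']
      simp [pow_succ]
    have h2 : ‖(D ^ m) x‖ ≤ ‖x‖ := by
      simpa using (D ^ m).le_of_opNorm_le hDm x
    rw [hp (D x)]
    linarith
  refine ⟨p, fun x => ?_, ⟨∑ k ∈ Finset.range m, ‖D ^ k‖ + 1, ?_, fun x => ?_⟩, fun x => ?_⟩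
  · rw [hp]
    simpa using Finset.single_le_sum (f := fun k => ‖(D ^ k) x‖) (fun _ _ => norm_nonneg _)
      (Finset.mem_range.2 hm)
  · positivity
  · rw [hp, add_mul, Finset.sum_mul]
    exact le_add_of_le_of_nonneg (Finset.sum_le_sum fun k _ => (D ^ k).le_opNorm x) (by positivity)
  · have hBD : B x = r • D x := by simp [hD, smul_smul, hr.ne']
    rw [hBD, map_smul_eq_mul, Real.norm_of_nonneg hr.le]
    exact mul_le_mul_of_nonneg_left (hpD x) hr.le

/-- If the Euler step `v ↦ v + h A v` contracts a continuous seminorm `p`, then along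
`ẋ = A x + u` the upper right derivative of `p ∘ x` is at most `-((1 - r) / h) p(x) + p(u)`. -/
theorem frequently_slope_seminorm_lt {E : Type*} [NormedAddCommGroup E] [NormedSpace ℝ E]
    {A : E →L[ℝ] E} {p : Seminorm ℝ E} {C h r : ℝ} (hpC : ∀ x, p x ≤ C * ‖x‖)
    (hh : 0 < h) (hA : ∀ v, p (v + h • A v) ≤ r * p v) {x : ℝ → E} {u : E} {t : ℝ}
    (hx : HasDerivAt x (A (x t) + u) t) {b : ℝ} (hb : -((1 - r) / h) * p (x t) + p u < b) :
    ∃ᶠ z in 𝓝[>] t, (z - t)⁻¹ * (p (x z) - p (x t)) < b := by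
  set d := b - (-((1 - r) / h) * p (x t) + p u) with hd
  have hd0 : 0 < d := sub_pos.2 hb
  have hslope : Tendsto (fun z => C * ‖slope x t z - (A (x t) + u)‖) (𝓝[>] t) (𝓝 0) := by
    have h1 := (hasDerivAt_iff_tendsto_slope.1 hx).mono_left
      (nhdsWithin_mono t fun z hz => ne_of_gt (mem_Ioi.1 hz))
    simpa using (tendsto_iff_norm_sub_tendsto_zero.1 h1).const_mul C
  refine Eventually.frequently ?_
  filter_upwards [hslope.eventually_lt_const hd0, Ioo_mem_nhdsGT (lt_add_of_pos_right t hh)]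
    with z hz hzt
  have hs : 0 < z - t := sub_pos.2 hzt.1
  have hsh : (z - t) / h ≤ 1 := (div_le_one hh).2 (by linarith [hzt.2])
  set w := slope x t z - (A (x t) + u) with hw
  have hxz : x z = (1 - (z - t) / h) • x t + (((z - t) / h) • (x t + h • A (x t)) +
      ((z - t) • u + (z - t) • w)) := by
    have h1 : x z = x t + (z - t) • slope x t z := by
      rw [slope_def_module, smul_smul, mul_inv_cancel₀ hs.ne']; simp
    have h2 : (z - t) / h * h = z - t := div_mul_cancel₀ _ hh.ne'
    rw [h1, hw, smul_add, smul_smul, h2]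
    module
  have hpz : p (x z) ≤ (1 - (z - t) / h) * p (x t) + ((z - t) / h * (r * p (x t)) +
      ((z - t) * p u + (z - t) * p w)) := by
    have hq : 0 ≤ (z - t) / h := by positivity
    rw [hxz]
    refine (map_add_le_add p _ _).trans (add_le_add ?_ ((map_add_le_add p _ _).trans
      (add_le_add ?_ ((map_add_le_add p _ _).trans (add_le_add ?_ ?_)))))
    · rw [map_smul_eq_mul, Real.norm_of_nonneg (sub_nonneg.2 hsh)]
    · rw [map_smul_eq_mul, Real.norm_of_nonneg hq]
      exact mul_le_mul_of_nonneg_left (hA _) hq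
    · rw [map_smul_eq_mul, Real.norm_of_nonneg hs.le]
    · rw [map_smul_eq_mul, Real.norm_of_nonneg hs.le]
  rw [inv_mul_lt_iff₀ hs]
  have hpw : (z - t) * p w < (z - t) * d := mul_lt_mul_of_pos_left ((hpC w).trans_lt hz) hs
  have : (z - t) * b = (z - t) * d + (1 - (z - t) / h) * p (x t) +
      (z - t) / h * (r * p (x t)) + (z - t) * p u - p (x t) := by
    rw [hd]; ring
  linarith

theorem tendsto_zero_of_hasDerivAt_add_perturbation {E : Type*} [NormedAddCommGroup E]
    [NormedSpace ℝ E] {A : E →L[ℝ] E} {p : Seminorm ℝ E} {C h r t₀ : ℝ} (hp : ∀ x, ‖x‖ ≤ p x)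
    (hpC : ∀ x, p x ≤ C * ‖x‖) (hh : 0 < h) (hr : r < 1)
    (hA : ∀ v, p (v + h • A v) ≤ r * p v) {x u : ℝ → E} {δ : ℝ → ℝ}
    (hx : ∀ t ≥ t₀, HasDerivAt x (A (x t) + u t) t)
    (hu : ∀ t, p (u t) ≤ δ t * (p (x t) + 1)) (hδ : Tendsto δ atTop (𝓝 0)) :
    Tendsto x atTop (𝓝 0) := by
  have hc : 0 < (1 - r) / h := div_pos (sub_pos.2 hr) hh
  set c := (1 - r) / h with hcdef
  have hpcont : Continuous p := Seminorm.continuous_of_le (q := C.toNNReal • normSeminorm ℝ E)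
    (by
      change Continuous fun y : E => (C.toNNReal : ℝ) * ‖y‖
      fun_prop)
    (fun y => (hpC y).trans (mul_le_mul_of_nonneg_right (Real.le_coe_toNNReal C) (norm_nonneg y)))
  suffices hpx : Tendsto (fun t => p (x t)) atTop (𝓝 0) from
    squeeze_zero_norm (fun t => hp (x t)) hpx
  refine tendsto_order.2 ⟨fun a ha => Eventually.of_forall fun t => ha.trans_le (apply_nonneg p _),
    fun η hη => ?_⟩
  set d := c * η / 4 with hd
  obtain ⟨T, hT⟩ := eventually_atTop.1 ((hδ.eventually_lt_const (half_pos hc)).and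
    ((hδ.eventually_lt_const (show 0 < d by positivity)).and (eventually_ge_atTop t₀)))
  have hbound : ∀ t ≥ T, p (x t) ≤ gronwallBound (p (x T)) (-(c / 2)) d (t - T) := by
    intro t ht
    refine le_gronwallBound_of_liminf_deriv_right_le (f := fun t => p (x t))
      (f' := fun t => -c * p (x t) + p (u t)) (b := t) ?_ ?_ le_rfl ?_ t ⟨ht, le_rfl⟩
    · exact hpcont.comp_continuousOn fun s hs =>
        (hx s (hT s hs.1).2.2).continuousAt.continuousWithinAt
    · exact fun s hs b hb => frequently_slope_seminorm_lt hpC hh hA (hx s (hT s hs.1).2.2) hb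
    · intro s hs
      obtain ⟨h1, h2, -⟩ := hT s hs.1
      have := mul_le_mul_of_nonneg_right h1.le (apply_nonneg p (x s))
      linarith [hu s]
  have hlim : Tendsto (fun t => gronwallBound (p (x T)) (-(c / 2)) d (t - T)) atTop
      (𝓝 (η / 2)) := by
    have hexp : Tendsto (fun t => Real.exp (-(c / 2) * (t - T))) atTop (𝓝 0) :=
      Real.tendsto_exp_atBot.comp ((tendsto_atTop_add_const_right atTop (-T)
        tendsto_id).const_mul_atTop_of_neg (by linarith))
    rw [gronwallBound_of_K_ne_0 (by linarith)]
    convert (hexp.const_mul (p (x T))).add ((hexp.sub_const 1).const_mul (d / -(c / 2))) using 2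
    rw [hd]
    field_simp
    ring
  filter_upwards [hlim.eventually_lt_const (half_lt_self hη), eventually_ge_atTop T] with t h1 h2
  exact (hbound t h2).trans_lt h1

open scoped Matrix.Norms.Operator

theorem Matrix.linfty_opNorm_map_ofReal {m n : Type*} [Fintype m] [Fintype n] (M : Matrix m n ℝ) :
    ‖M.map Complex.ofReal‖ = ‖M‖ := by
  simp [Matrix.linfty_opNorm_def]

/-- A real matrix `F` that is Hurwitz admits a step size `h` and an equivalent norm on `ℝⁿ` in which
the Euler step `v ↦ v + h F v` is a contraction. -/
theorem Matrix.exists_seminorm_euler_step_contracting {n : ℕ} (F : Matrix (Fin n) (Fin n) ℝ)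
    (hF : ∀ μ ∈ spectrum ℂ (F.map Complex.ofReal), μ.re < 0) :
    ∃ (p : Seminorm ℝ (Fin n → ℝ)) (C h r : ℝ), 0 < C ∧ 0 < h ∧ r < 1 ∧ (∀ x, ‖x‖ ≤ p x) ∧
      (∀ x, p x ≤ C * ‖x‖) ∧ ∀ v, p (v + h • (F *ᵥ v)) ≤ r * p v := by
  rcases n.eq_zero_or_pos with rfl | hn
  · exact ⟨normSeminorm ℝ _, 1, 1, 0, one_pos, one_pos, one_pos, fun x => le_rfl,
      fun x => (one_mul ‖x‖).ge, fun v => by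
      rw [Subsingleton.elim v 0]; simp⟩
  have : Nonempty (Fin n) := ⟨⟨0, hn⟩⟩
  obtain ⟨h, hh, hrad⟩ := exists_spectralRadius_one_add_smul_lt_one _ hF
  obtain ⟨r, hr0, hr1, m, hm, hpow⟩ := exists_norm_pow_le_pow_of_spectralRadius_lt_one _ hrad
  have hmap : (1 + (h : ℂ) • F.map Complex.ofReal) ^ m =
      ((1 + h • F) ^ m).map Complex.ofReal := by
    have h1 : 1 + (h : ℂ) • F.map Complex.ofReal = Complex.ofRealHom.mapMatrix (1 + h • F) := by
      rw [map_add, map_one]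
      congr 1
      ext i j
      simp
    rw [h1, ← map_pow]
    rfl
  rw [hmap, Matrix.linfty_opNorm_map_ofReal] at hpow
  set B : (Fin n → ℝ) →L[ℝ] (Fin n → ℝ) := LinearMap.toContinuousLinearMap (1 + h • F).mulVecLin
    with hB
  have hBv : ∀ v, B v = (1 + h • F) *ᵥ v := fun v => rfl
  have hBk : ∀ (k : ℕ) v, (B ^ k) v = ((1 + h • F) ^ k) *ᵥ v := fun k => by
    induction k with
    | zero => simp
    | succ k ih =>
      intro v
      rw [pow_succ, pow_succ, mul_apply_eq_comp, ih, hBv, mulVec_mulVec]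
  obtain ⟨p, hp, ⟨C, hC, hpC⟩, hpB⟩ := exists_seminorm_contracting B hr0 hm
    (ContinuousLinearMap.opNorm_le_bound _ (by positivity) fun v => by
      rw [hBk]
      exact (linfty_opNorm_mulVec _ _).trans (mul_le_mul_of_nonneg_right hpow (norm_nonneg v)))
  refine ⟨p, C, h, r, hC, hh, hr1, hp, hpC, fun v => ?_⟩
  simpa [hBv, add_mulVec, smul_mulVec] using hpB v

theorem tendsto_zero_of_hurwitz_perturbation {n : ℕ} {t₀ ε : ℝ} (hε : 0 < ε)
    {F : Matrix (Fin n) (Fin n) ℝ} (hF : ∀ μ ∈ spectrum ℂ (F.map Complex.ofReal), μ.re < 0)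
    {F₁ : ℝ → Matrix (Fin n) (Fin n) ℝ} {F₂ : ℝ → Fin n → ℝ}
    (hF₁ : Tendsto F₁ atTop (𝓝 0)) (hF₂ : Tendsto F₂ atTop (𝓝 0)) {x : ℝ → Fin n → ℝ}
    (hx : ∀ t ≥ t₀, HasDerivAt x (ε • (F *ᵥ x t) + F₁ t *ᵥ x t + F₂ t) t) :
    Tendsto x atTop (𝓝 0) := by
  obtain ⟨p, C, h, r, hC, hh, hr, hp, hpC, hpF⟩ := F.exists_seminorm_euler_step_contracting hF
  refine tendsto_zero_of_hasDerivAt_add_perturbation (t₀ := t₀) (h := h / ε)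
    (A := LinearMap.toContinuousLinearMap (ε • F.mulVecLin)) (u := fun t => F₁ t *ᵥ x t + F₂ t)
    (δ := fun t => C * (‖F₁ t‖ + ‖F₂ t‖)) hp hpC (div_pos hh hε) hr (fun v => ?_)
    (fun t ht => ?_) (fun t => ?_) ?_
  · simpa [smul_smul, div_mul_cancel₀ _ hε.ne'] using hpF v
  · simpa [add_assoc] using hx t ht
  · rw [mul_assoc]
    refine (hpC _).trans (mul_le_mul_of_nonneg_left ?_ hC.le)
    have h1 := (norm_add_le (F₁ t *ᵥ x t) (F₂ t)).trans
      (add_le_add_left (linfty_opNorm_mulVec (F₁ t) (x t)) _)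
    have h2 := mul_le_mul_of_nonneg_left (hp (x t)) (norm_nonneg (F₁ t))
    have h3 := mul_nonneg (norm_nonneg (F₂ t)) (apply_nonneg p (x t))
    linarith [norm_nonneg (F₁ t)]
  · simpa using (hF₁.norm.add hF₂.norm).const_mul C

end PerturbationLemma

/-- Perturbation lemma, part (i): `ẋ = εFx + F₁(t)x + F₂(t)` with `F` Hurwitz,
`F₁, F₂` continuous, bounded and tending to zero, implies `x(t) → 0`. -/
theorem stmt_1 (n : ℕ) (t₀ ε : ℝ) (hε : 0 < ε)
    (F : Matrix (Fin n) (Fin n) ℝ)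
    (hF : ∀ μ ∈ spectrum ℂ (F.map Complex.ofReal), μ.re < 0)
    (F₁ : ℝ → Matrix (Fin n) (Fin n) ℝ) (F₂ : ℝ → (Fin n → ℝ))
    (hF₁cont : ContinuousOn F₁ (Set.Ici t₀))
    (hF₂cont : ContinuousOn F₂ (Set.Ici t₀))
    (hF₁bdd : ∃ M, ∀ t ≥ t₀, ∀ i j, |F₁ t i j| ≤ M)
    (hF₂bdd : ∃ M, ∀ t ≥ t₀, ∀ i, |F₂ t i| ≤ M)
    (hF₁lim : Tendsto F₁ atTop (nhds 0))
    (hF₂lim : Tendsto F₂ atTop (nhds 0))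
    (x : ℝ → (Fin n → ℝ))
    (hx : ∀ t ≥ t₀, HasDerivAt x (ε • (F *ᵥ x t) + F₁ t *ᵥ x t + F₂ t) t) :
    Tendsto x atTop (nhds 0) := by
  exact tendsto_zero_of_hurwitz_perturbation hε hF hF₁lim hF₂lim hx
end

section
/- Let F ∈ ℝ^{n×n} be Hurwitz, let α_F := min{ -Re(μ) : μ an eigenvalue of F } > 0, and let α > 0, ε > 0 satisfy ε·α_F > α. Suppose F₂ : [t₀,∞) → ℝ^n is continuous and there is c ≥ 0 with ‖F₂(t)‖ ≤ c·e^{-α t} for all t ≥ t₀. If x : [t₀,∞) → ℝ^n is differentiable and satisfies ẋ(t) = ε F x(t) + F₂(t) for all t ≥ t₀, then there exists K ≥ 0 such that ‖x(t)‖ ≤ K·e^{-α t} for all t ≥ t₀; in particular x(t) → 0 exponentially at rate α. -/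
open Matrix Filter

/-- Solutions of `y' = μ y + h` inherit the decay rate of `h` when it is slower than `-Re μ`. -/
theorem exists_norm_le_exp_of_hasDerivAt_smul_add {E : Type*} [NormedAddCommGroup E]
    [NormedSpace ℂ E] [NormedSpace ℝ E] [IsScalarTower ℝ ℂ E] {t₀ α C : ℝ} {μ : ℂ}
    (hμ : μ.re < -α) {y h : ℝ → E} (hy : ∀ t ≥ t₀, HasDerivAt y (μ • y t + h t) t)
    (hh : ∀ t ≥ t₀, ‖h t‖ ≤ C * Real.exp (-α * t)) :
    ∃ K, ∀ t ≥ t₀, ‖y t‖ ≤ K * Real.exp (-α * t) := by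
  obtain ⟨β, hβ, hβμ⟩ : ∃ β : ℝ, 0 < β ∧ μ.re = -α - β := ⟨-α - μ.re, by linarith, by ring⟩
  have hnorm (t : ℝ) : ‖Complex.exp (-μ * t)‖ = Real.exp ((α + β) * t) := by
    simp [Complex.norm_exp, hβμ]
    ring
  set u : ℝ → E := fun t => Complex.exp (-μ * t) • y t with hu
  have hu' : ∀ t ≥ t₀, HasDerivAt u (Complex.exp (-μ * t) • h t) t := by
    intro t ht
    have hlin : HasDerivAt (fun s : ℝ => -μ * (s : ℂ)) (-μ) t := by
      simpa using (Complex.ofRealCLM.hasDerivAt (x := t)).const_mul (-μ)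
    refine (hlin.cexp.smul (hy t ht)).congr_deriv ?_
    module
  have hB (t : ℝ) : HasDerivAt (fun s => ‖u t₀‖ + C / β * (Real.exp (β * s) - Real.exp (β * t₀)))
      (C * Real.exp (β * t)) t := by
    have hexp : HasDerivAt (fun s : ℝ => Real.exp (β * s)) (Real.exp (β * t) * β) t := by
      simpa using ((hasDerivAt_id t).const_mul β).exp
    refine (((hexp.sub_const (Real.exp (β * t₀))).const_mul (C / β)).const_add _).congr_deriv ?_
    field_simp
  have hC : 0 ≤ C :=
    nonneg_of_mul_nonneg_left ((norm_nonneg _).trans (hh t₀ le_rfl)) (Real.exp_pos _)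
  refine ⟨‖u t₀‖ * Real.exp (-β * t₀) + C / β, fun t ht => ?_⟩
  have hut : ‖u t‖ ≤ ‖u t₀‖ + C / β * (Real.exp (β * t) - Real.exp (β * t₀)) := by
    refine image_norm_le_of_norm_deriv_right_le_deriv_boundary (a := t₀) (b := t)
      (f' := fun t => Complex.exp (-μ * t) • h t)
      (fun s hs => (hu' s hs.1).continuousAt.continuousWithinAt)
      (fun s hs => (hu' s hs.1).hasDerivWithinAt) (by simp) hB (fun s hs => ?_) ⟨ht, le_rfl⟩
    rw [norm_smul, hnorm]
    calc Real.exp ((α + β) * s) * ‖h s‖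
        ≤ Real.exp ((α + β) * s) * (C * Real.exp (-α * s)) := by gcongr; exact hh s hs.1
      _ = C * Real.exp (β * s) := by
        rw [mul_left_comm, ← Real.exp_add]
        ring_nf
  have hyu : ‖y t‖ = Real.exp (-(α + β) * t) * ‖u t‖ := by
    rw [hu, norm_smul, hnorm, ← mul_assoc, ← Real.exp_add, ← add_mul,
      neg_add_cancel, zero_mul, Real.exp_zero, one_mul]
  calc ‖y t‖ ≤ Real.exp (-(α + β) * t) * (‖u t₀‖ + C / β * Real.exp (β * t)) := by
        rw [hyu]
        gcongr
        refine hut.trans ?_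
        gcongr
        linarith [Real.exp_pos (β * t₀)]
    _ = (‖u t₀‖ * Real.exp (-β * t) + C / β) * Real.exp (-α * t) := by
        rw [show -(α + β) * t = -β * t + -α * t by ring, Real.exp_add]
        have : Real.exp (-β * t) * Real.exp (β * t) = 1 := by rw [← Real.exp_add]; simp
        linear_combination C / β * Real.exp (-α * t) * this
    _ ≤ (‖u t₀‖ * Real.exp (-β * t₀) + C / β) * Real.exp (-α * t) := by
        gcongr ?_ * _
        gcongr ‖u t₀‖ * Real.exp ?_ + _
        exact mul_le_mul_of_nonpos_left ht (by linarith)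

/-- If `y' = T y + g` with `g = O(e^{-αt})`, and applying `∏ (T - μ)` to `y` gives `O(e^{-αt})`
for some numbers `μ` with `Re μ < -α`, then `y = O(e^{-αt})`. -/
theorem exists_norm_le_exp_of_aeval_prod {E : Type*} [NormedAddCommGroup E]
    [NormedSpace ℂ E] [NormedSpace ℝ E] [IsScalarTower ℝ ℂ E] {t₀ α C : ℝ} (T : E →L[ℂ] E)
    {y g : ℝ → E} (hy : ∀ t ≥ t₀, HasDerivAt y (T (y t) + g t) t)
    (hg : ∀ t ≥ t₀, ‖g t‖ ≤ C * Real.exp (-α * t)) (s : Multiset ℂ) (hs : ∀ μ ∈ s, μ.re < -α)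
    (hp : ∃ K, ∀ t ≥ t₀, ‖Polynomial.aeval T
      (s.map fun μ => Polynomial.X - Polynomial.C μ).prod (y t)‖ ≤ K * Real.exp (-α * t)) :
    ∃ K, ∀ t ≥ t₀, ‖y t‖ ≤ K * Real.exp (-α * t) := by
  induction s using Multiset.induction with
  | empty => simpa using hp
  | cons μ s ih =>
    refine ih (fun ν hν => hs ν (Multiset.mem_cons_of_mem hν)) ?_
    obtain ⟨K, hK⟩ := hp
    set p := (s.map fun μ => Polynomial.X - Polynomial.C μ).prod
    set S : E →L[ℂ] E := Polynomial.aeval T p with hS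
    have hcomm (v : E) : S (T v) = T (S v) := by
      have : S * T = T * S := by
        have := ((Polynomial.commute_X p).symm.map (Polynomial.aeval T)).eq
        rwa [Polynomial.aeval_X] at this
      exact DFunLike.congr_fun this v
    have hcons (v : E) : Polynomial.aeval T
        ((μ ::ₘ s).map fun μ => Polynomial.X - Polynomial.C μ).prod v = T (S v) - μ • S v := by
      simp [p, hS, Algebra.algebraMap_eq_smul_one]
    refine exists_norm_le_exp_of_hasDerivAt_smul_add (hs μ (Multiset.mem_cons_self μ s))
      (h := fun t => (T (S (y t)) - μ • S (y t)) + S (g t)) (C := K + ‖S‖ * C) ?_ ?_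
    · intro t ht
      refine ((S.restrictScalars ℝ).hasFDerivAt.comp_hasDerivAt t (hy t ht)).congr_deriv ?_
      simp only [ContinuousLinearMap.coe_restrictScalars', map_add, hcomm]
      abel
    · intro t ht
      rw [add_mul, mul_assoc]
      refine norm_add_le_of_le ((hcons (y t)) ▸ hK t ht) ((S.le_opNorm _).trans ?_)
      gcongr
      exact hg t ht

/-- A linear system `y' = M y + g` with `g = O(e^{-αt})` has solutions `O(e^{-αt})` when the
spectrum of `M` lies in `Re μ < -α`. -/
theorem exists_norm_le_exp_of_spectrum {n : ℕ} {t₀ α C : ℝ} (M : Matrix (Fin n) (Fin n) ℂ)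
    (hM : ∀ μ ∈ spectrum ℂ M, μ.re < -α) {y g : ℝ → EuclideanSpace ℂ (Fin n)}
    (hy : ∀ t ≥ t₀, HasDerivAt y (Matrix.toEuclideanLin M (y t) + g t) t)
    (hg : ∀ t ≥ t₀, ‖g t‖ ≤ C * Real.exp (-α * t)) :
    ∃ K, ∀ t ≥ t₀, ‖y t‖ ≤ K * Real.exp (-α * t) := by
  refine exists_norm_le_exp_of_aeval_prod (Matrix.toEuclideanCLM (𝕜 := ℂ) M) hy hg
    M.charpoly.roots (fun μ hμ => hM μ ?_) ⟨0, fun t _ => ?_⟩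
  · exact Matrix.mem_spectrum_iff_isRoot_charpoly.2 (Polynomial.isRoot_of_mem_roots hμ)
  · rw [← (IsAlgClosed.splits M.charpoly).eq_prod_roots_of_monic M.charpoly_monic]
    have : Polynomial.aeval (Matrix.toEuclideanCLM (𝕜 := ℂ) M) M.charpoly = 0 := by
      have := Polynomial.aeval_algHom_apply
        (Matrix.toEuclideanCLM (n := Fin n) (𝕜 := ℂ)).toAlgEquiv.toAlgHom M M.charpoly
      rw [Matrix.aeval_self_charpoly, map_zero] at this
      exact this
    simp [this]


/-- Perturbation lemma, part (ii): `ẋ = εFx + F₂(t)` with `F` Hurwitz,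
`α_F = min{-Re μ : μ ∈ spec F}`, `ε·α_F > α > 0`, and `‖F₂(t)‖ ≤ c e^{-αt}`,
implies `‖x(t)‖ ≤ K e^{-αt}`. -/
theorem stmt_2 (n : ℕ) (t₀ ε α αF c : ℝ) (hε : 0 < ε) (hα : 0 < α) (hc : 0 ≤ c)
    (F : Matrix (Fin n) (Fin n) ℝ)
    (hF : ∀ μ ∈ spectrum ℂ (F.map Complex.ofReal), μ.re < 0)
    (hαF : IsLeast ((fun μ : ℂ => -μ.re) '' spectrum ℂ (F.map Complex.ofReal)) αF)
    (hαFpos : 0 < αF)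
    (hεα : α < ε * αF)
    (F₂ : ℝ → EuclideanSpace ℝ (Fin n))
    (hF₂cont : ContinuousOn F₂ (Set.Ici t₀))
    (hF₂ : ∀ t ≥ t₀, ‖F₂ t‖ ≤ c * Real.exp (-α * t))
    (x : ℝ → EuclideanSpace ℝ (Fin n))
    (hx : ∀ t ≥ t₀, HasDerivAt x (ε • (Matrix.toEuclideanLin F (x t)) + F₂ t) t) :
    ∃ K ≥ 0, ∀ t ≥ t₀, ‖x t‖ ≤ K * Real.exp (-α * t) := by
  let L : EuclideanSpace ℝ (Fin n) →ₗ[ℝ] EuclideanSpace ℂ (Fin n) :=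
    { toFun := fun v => WithLp.toLp 2 fun i => (v i : ℂ)
      map_add' := fun v w => by ext i; simp
      map_smul' := fun r v => by ext i; simp }
  have hL (v) : ‖L v‖ = ‖v‖ := by simp [L, EuclideanSpace.norm_eq]
  have hLF (v) : L (Matrix.toEuclideanLin F v) =
      Matrix.toEuclideanLin (F.map Complex.ofReal) (L v) := by
    ext i
    simp [L, Matrix.toLpLin_apply, Matrix.mulVec, dotProduct]
  have hspec : ∀ μ ∈ spectrum ℂ ((ε : ℂ) • F.map Complex.ofReal), μ.re < -α := by
    intro μ hμ
    have hε' : (ε : ℂ) ≠ 0 := by exact_mod_cast hε.ne'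
    rw [← Units.smul_mk0 hε', spectrum.unit_smul_eq_smul] at hμ
    obtain ⟨ν, hν, rfl⟩ := hμ
    have := mul_le_mul_of_nonneg_left (hαF.2 ⟨ν, hν, rfl⟩) hε.le
    simp only [smul_eq_mul, Units.val_mk0, Complex.re_ofReal_mul]
    linarith
  obtain ⟨K, hK⟩ := exists_norm_le_exp_of_spectrum (t₀ := t₀) (C := c) _ hspec
    (y := fun t => L (x t)) (g := fun t => L (F₂ t))
    (fun t ht => by
      refine ((LinearMap.toContinuousLinearMap L).hasFDerivAt.comp_hasDerivAt t
        (hx t ht)).congr_deriv ?_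
      rw [LinearMap.coe_toContinuousLinearMap', map_add, map_smul, hLF, map_smul,
        LinearMap.smul_apply, Complex.coe_smul])
    (fun t ht => by simpa only [hL] using hF₂ t ht)
  simp only [hL] at hK
  exact ⟨K, nonneg_of_mul_nonneg_left ((norm_nonneg _).trans (hK t₀ le_rfl)) (Real.exp_pos _), hK⟩
end

section
/- Let A ∈ ℝ^{n×n} and σ > 0 satisfy vᵀ(Av) ≥ σ‖v‖² for every v ∈ ℝ^n (Euclidean norm). Let c : ℝ → ℝ be a measurable function with c(t) ∈ {0,1} for all t, and let x : [t₀,∞) → ℝ^n be differentiable with ẋ(t) = −c(t)·(A x(t)) for all t ≥ t₀. Then for all t ≥ t₀, ‖x(t)‖ ≤ ‖x(t₀)‖ · exp(−σ ∫_{t₀}^t c(s) ds). -/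
open Matrix MeasureTheory intervalIntegral
open scoped RealInnerProductSpace

/-- If a positive function `u` satisfies the differential inequality `u' ≤ k u` with `k` merely
integrable, then it satisfies the Grönwall bound `u b ≤ u a * exp (∫ k)`. -/
theorem le_mul_exp_integral_of_hasDerivAt_le {u u' k : ℝ → ℝ} {a b : ℝ} (hab : a ≤ b)
    (hu : ∀ s ∈ Set.Icc a b, HasDerivAt u (u' s) s) (hpos : ∀ s ∈ Set.Icc a b, 0 < u s)
    (hk : IntegrableOn k (Set.Icc a b)) (hle : ∀ s ∈ Set.Icc a b, u' s ≤ k s * u s) :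
    u b ≤ u a * Real.exp (∫ s in a..b, k s) := by
  have hlog : ∀ s ∈ Set.Icc a b, HasDerivAt (fun s => Real.log (u s)) (u' s / u s) s :=
    fun s hs => (hu s hs).log (hpos s hs).ne'
  have h := sub_le_integral_of_hasDeriv_right_of_le hab
    (fun s hs => (hlog s hs).continuousAt.continuousWithinAt)
    (fun s hs => (hlog s (Set.Ioo_subset_Icc_self hs)).hasDerivWithinAt) hk
    (fun s hs => by
      have hs' := Set.Ioo_subset_Icc_self hs
      exact (div_le_iff₀ (hpos s hs')).2 (hle s hs'))
  have hb := hpos b (Set.right_mem_Icc.2 hab)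
  have ha := hpos a (Set.left_mem_Icc.2 hab)
  calc u b = Real.exp (Real.log (u b)) := (Real.exp_log hb).symm
    _ ≤ Real.exp (Real.log (u a) + ∫ s in a..b, k s) := Real.exp_le_exp.2 (by linarith)
    _ = u a * Real.exp (∫ s in a..b, k s) := by rw [Real.exp_add, Real.exp_log ha]

/-- A switched consensus-type error system `ẋ = -c(t)·A x`, where the symmetric part of
`A` is bounded below by `σ·I` and `c(t) ∈ {0,1}`, decays like
`‖x(t)‖ ≤ ‖x(t₀)‖·exp(-σ ∫_{t₀}^t c)`. -/
theorem stmt_5 (n : ℕ) (t₀ σ : ℝ) (hσ : 0 < σ)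
    (A : Matrix (Fin n) (Fin n) ℝ)
    (hA : ∀ v : EuclideanSpace ℝ (Fin n), σ * ‖v‖ ^ 2 ≤ ⟪v, Matrix.toEuclideanLin A v⟫)
    (c : ℝ → ℝ) (hc_meas : Measurable c) (hc : ∀ t, c t = 0 ∨ c t = 1)
    (x : ℝ → EuclideanSpace ℝ (Fin n))
    (hx : ∀ t ≥ t₀, HasDerivAt x (-(c t) • Matrix.toEuclideanLin A (x t)) t) :
    ∀ t ≥ t₀, ‖x t‖ ≤ ‖x t₀‖ * Real.exp (-σ * ∫ s in t₀..t, c s) := by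
  intro t ht
  have hc0 : ∀ s, 0 ≤ c s := fun s => by rcases hc s with h | h <;> simp [h]
  have hder : ∀ s ≥ t₀, HasDerivAt (fun s => ‖x s‖ ^ 2)
      (-2 * c s * ⟪x s, Matrix.toEuclideanLin A (x s)⟫) s := fun s hs => by
    convert (hx s hs).norm_sq using 1
    rw [inner_smul_right]
    ring
  have hle : ∀ s, -2 * c s * ⟪x s, Matrix.toEuclideanLin A (x s)⟫ ≤
      -2 * σ * c s * ‖x s‖ ^ 2 := fun s => by
    nlinarith [mul_le_mul_of_nonneg_left (hA (x s)) (hc0 s)]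
  have hanti : AntitoneOn (fun s => ‖x s‖ ^ 2) (Set.Ici t₀) := by
    refine antitoneOn_of_hasDerivWithinAt_nonpos (convex_Ici t₀)
      (fun s hs => (hder s hs).continuousAt.continuousWithinAt)
      (fun s hs => (hder s (interior_subset hs)).hasDerivWithinAt) fun s _ => (hle s).trans ?_
    have : 0 ≤ σ * c s * ‖x s‖ ^ 2 := mul_nonneg (mul_nonneg hσ.le (hc0 s)) (sq_nonneg _)
    linarith
  rcases eq_or_ne (x t) 0 with h0 | h0
  · rw [h0, norm_zero]
    positivity
  have hpos : ∀ s ∈ Set.Icc t₀ t, 0 < ‖x s‖ ^ 2 := fun s hs =>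
    (pow_pos (norm_pos_iff.2 h0) 2).trans_le (hanti hs.1 ht hs.2)
  have hint : IntegrableOn (fun s => -2 * σ * c s) (Set.Icc t₀ t) := by
    refine Integrable.const_mul ?_ _
    refine Measure.integrableOn_of_bounded (M := 1) (by simp) hc_meas.aestronglyMeasurable
      (Filter.Eventually.of_forall fun s => ?_)
    rcases hc s with h | h <;> simp [h]
  have h := le_mul_exp_integral_of_hasDerivAt_le ht (fun s hs => hder s hs.1) hpos hint
    fun s _ => hle s
  refine (pow_le_pow_iff_left₀ (norm_nonneg _) (by positivity) two_ne_zero).1 ?_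
  rw [intervalIntegral.integral_const_mul] at h
  rw [mul_pow, ← Real.exp_nat_mul]
  refine h.trans_eq ?_
  congr 2
  push_cast
  ring
end

section
/- Let t₀ ∈ ℝ and let c : ℝ → ℝ be measurable with c(t) ∈ {0,1} for all t. Let a ∈ ℝ, b > 0, T₀ ≥ 0, τ > 1, c_f ≥ 0 and λ ≥ 0 be constants such that: (duration condition) ∫_s^t (1 − c(r)) dr ≤ T₀ + (t−s)/τ for all t₀ ≤ s ≤ t, and η := b(1 − 1/τ) − a > λ. If u : [t₀,∞) → ℝ is a nonnegative differentiable function satisfying u'(t) ≤ (a − b·c(t))·u(t) + c_f·e^{−λ(t−t₀)} for all t ≥ t₀, then for all t ≥ t₀, u(t) ≤ e^{b·T₀}·( u(t₀)·e^{−η(t−t₀)} + (c_f/(η−λ))·e^{−λ(t−t₀)} ). In particular u(t) → 0 exponentially as t → ∞. -/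
open MeasureTheory intervalIntegral

/-- A function integrable on `[t₀, T]` is `L¹`-close to a continuous one. -/
theorem exists_continuous_integral_abs_sub_le {c : ℝ → ℝ} {t₀ T ε : ℝ} (hT : t₀ ≤ T)
    (hc : IntervalIntegrable c volume t₀ T) (hε : 0 < ε) :
    ∃ d : ℝ → ℝ, Continuous d ∧ ∫ r in t₀..T, |c r - d r| ≤ ε := by
  obtain ⟨d, -, hd, hdc, -⟩ :=
    Integrable.exists_hasCompactSupport_integral_sub_le
      ((intervalIntegrable_iff_integrableOn_Ioc_of_le hT).1 hc) hε
  exact ⟨d, hdc, by simpa [integral_of_le hT] using hd⟩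

/-- Under a duration bound, a continuous `L¹`-approximation `d` of `c` gives an integrating factor
`exp (a (T - r) - b ∫ d)` which decays at the average rate `η = b (1 - 1 / τ) - a`. -/
theorem exp_sub_integral_le_of_duration {t₀ T a b T₀ τ ε : ℝ} (hb : 0 ≤ b) {c d : ℝ → ℝ}
    (hci : ∀ s t, IntervalIntegrable c volume s t)
    (hdur : ∀ s t : ℝ, t₀ ≤ s → s ≤ t → (∫ r in s..t, (1 - c r)) ≤ T₀ + (t - s) / τ)
    (hd : Continuous d) (hcd : ∫ r in t₀..T, |c r - d r| ≤ ε) {r : ℝ} (hr : t₀ ≤ r) (hrT : r ≤ T) :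
    Real.exp (a * (T - r) - b * ∫ x in r..T, d x) ≤
      Real.exp (b * (T₀ + ε)) * Real.exp (-(b * (1 - 1 / τ) - a) * (T - r)) := by
  have hdi (s t : ℝ) : IntervalIntegrable d volume s t := hd.intervalIntegrable s t
  have hi (s t : ℝ) : IntervalIntegrable (fun x => |c x - d x|) volume s t :=
    ((hci s t).sub (hdi s t)).abs
  have hdist : ∫ x in r..T, (c x - d x) ≤ ε := by
    have hle : ∫ x in r..T, (c x - d x) ≤ ∫ x in r..T, |c x - d x| :=
      integral_mono_on hrT ((hci r T).sub (hdi r T)) (hi r T) fun x _ => le_abs_self _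
    have hsplit := integral_add_adjacent_intervals (hi t₀ r) (hi r T)
    have hnonneg : 0 ≤ ∫ x in t₀..r, |c x - d x| :=
      integral_nonneg hr fun x _ => abs_nonneg _
    linarith
  rw [integral_sub (hci r T) (hdi r T)] at hdist
  have hwin := hdur r T hr hrT
  rw [integral_sub intervalIntegrable_const (hci r T), intervalIntegral.integral_const] at hwin
  simp only [smul_eq_mul, mul_one] at hwin
  have hkey : T - r - ∫ x in r..T, d x ≤ T₀ + ε + (T - r) / τ := by linarith
  rw [← Real.exp_add, Real.exp_le_exp]
  have hmul := mul_le_mul_of_nonneg_left hkey hb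
  have hdiv : b * ((T - r) / τ) = b * (1 / τ) * (T - r) := by ring
  linarith

/-- The decay estimate of the switched differential inequality at time `T`, up to an error coming
from an `ε`-close continuous approximation `d` of the switching signal `c`. -/
theorem switched_le_of_continuous_approx {t₀ T a b T₀ τ c_f lam ε M : ℝ}
    (hb : 0 < b) (hcf : 0 ≤ c_f) (hlam : 0 ≤ lam) (hη : lam < b * (1 - 1 / τ) - a)
    {c d : ℝ → ℝ} (hci : ∀ s t, IntervalIntegrable c volume s t)
    (hdur : ∀ s t : ℝ, t₀ ≤ s → s ≤ t → (∫ r in s..t, (1 - c r)) ≤ T₀ + (t - s) / τ)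
    (hd : Continuous d) (hcd : ∫ r in t₀..T, |c r - d r| ≤ ε)
    {u u' : ℝ → ℝ} (hu0 : ∀ t ≥ t₀, 0 ≤ u t) (hderiv : ∀ t ≥ t₀, HasDerivAt u (u' t) t)
    (hineq : ∀ t ≥ t₀, u' t ≤ (a - b * c t) * u t + c_f * Real.exp (-lam * (t - t₀)))
    (hT : t₀ ≤ T) (hM : ∀ r ∈ Set.Icc t₀ T, u r ≤ M) :
    u T ≤ Real.exp (b * (T₀ + ε)) *
      (u t₀ * Real.exp (-(b * (1 - 1 / τ) - a) * (T - t₀)) +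
        c_f / ((b * (1 - 1 / τ) - a) - lam) * Real.exp (-lam * (T - t₀)) + b * M * ε) := by
  have hbound {r : ℝ} (hr : t₀ ≤ r) (hrT : r ≤ T) :=
    exp_sub_integral_le_of_duration (a := a) hb.le hci hdur hd hcd hr hrT
  set η := b * (1 - 1 / τ) - a
  set K := Real.exp (b * (T₀ + ε))
  have hK : 0 < K := Real.exp_pos _
  have hM0 : 0 ≤ M := (hu0 t₀ le_rfl).trans (hM t₀ ⟨le_rfl, hT⟩)
  set E : ℝ → ℝ := fun r => Real.exp (a * (T - r) - b * ∫ x in r..T, d x)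
  set H : ℝ → ℝ := fun r => Real.exp (-η * (T - r)) * Real.exp (-lam * (r - t₀))
  have hE (r : ℝ) : HasDerivAt E (E r * (-(a - b * d r))) r := by
    have h1 : HasDerivAt (fun r => ∫ x in r..T, d x) (-d r) r :=
      integral_hasDerivAt_left (hd.intervalIntegrable r T)
        hd.aestronglyMeasurable.stronglyMeasurableAtFilter hd.continuousAt
    have h2 := ((((hasDerivAt_id r).const_sub T).const_mul a).sub (h1.const_mul b)).exp
    refine h2.congr_deriv ?_
    simp only [E, id, Pi.sub_apply]
    ring
  have hH (r : ℝ) : HasDerivAt H (H r * (η - lam)) r := by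
    have h1 := (((hasDerivAt_id r).const_sub T).const_mul (-η)).exp
    have h2 := (((hasDerivAt_id r).sub_const t₀).const_mul (-lam)).exp
    refine (h1.mul h2).congr_deriv ?_
    simp only [H, id]
    ring
  have hG (r : ℝ) (hr : t₀ ≤ r) := ((hE r).mul (hderiv r hr)).sub
    ((hH r).const_mul (K * (c_f / (η - lam))))
  have hmain := sub_le_integral_of_hasDeriv_right_of_le
    (φ := fun r => K * b * M * |c r - d r|) hT
    (fun r hr => (hG r hr.1).continuousAt.continuousWithinAt)
    (fun r hr => (hG r hr.1.le).hasDerivWithinAt)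
    ((intervalIntegrable_iff_integrableOn_Icc_of_le hT).1
      (((hci t₀ T).sub (hd.intervalIntegrable t₀ T)).abs.const_mul _))
    (fun r hr => by
      have hr0 := hr.1.le
      have hEpos : 0 < E r := Real.exp_pos _
      have hEle : E r ≤ K * Real.exp (-η * (T - r)) := hbound hr0 hr.2.le
      have hEK : E r ≤ K := hEle.trans <| mul_le_of_le_one_right hK.le <|
        Real.exp_le_one_iff.2 (by nlinarith [hr.2, hr.1])
      have hcancel : K * (c_f / (η - lam)) * (H r * (η - lam)) = K * c_f * H r := by
        have : η - lam ≠ 0 := by linarith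
        field_simp
      rw [hcancel]
      have hf : E r * (c_f * Real.exp (-lam * (r - t₀))) ≤ K * c_f * H r :=
        (mul_le_mul_of_nonneg_right hEle (by positivity)).trans_eq (by simp only [H]; ring)
      have herr : E r * (b * ((d r - c r) * u r)) ≤ K * b * M * |c r - d r| := by
        have h1 : (d r - c r) * u r ≤ |c r - d r| * M := by
          rw [abs_sub_comm]
          exact mul_le_mul (le_abs_self _) (hM r ⟨hr0, hr.2.le⟩) (hu0 r hr0) (abs_nonneg _)
        calc E r * (b * ((d r - c r) * u r)) ≤ E r * (b * (|c r - d r| * M)) := by gcongr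
          _ ≤ K * (b * (|c r - d r| * M)) := by gcongr
          _ = K * b * M * |c r - d r| := by ring
      have hu' := mul_le_mul_of_nonneg_left (hineq r hr0) hEpos.le
      linarith)
  have hint : ∫ r in t₀..T, K * b * M * |c r - d r| ≤ K * b * M * ε := by
    rw [intervalIntegral.integral_const_mul]
    gcongr
  have hET : E T = 1 := by simp [E]
  have hHT : H T = Real.exp (-lam * (T - t₀)) := by simp [H]
  have hE0 : E t₀ * u t₀ ≤ K * Real.exp (-η * (T - t₀)) * u t₀ :=
    mul_le_mul_of_nonneg_right (hbound le_rfl hT) (hu0 t₀ le_rfl)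
  have hH0 : 0 ≤ K * (c_f / (η - lam)) * H t₀ := by
    have : 0 < η - lam := by linarith
    positivity
  simp only [Pi.sub_apply, Pi.mul_apply, hET, hHT] at hmain
  linarith

/-- Switched differential inequality under a DoS attack-duration bound: the state grows
at rate `a` during attack intervals (`c = 0`), decays at net rate `b - a` during normal
intervals (`c = 1`), and is driven by an input decaying at rate `lam`; if the total
attack time in any window `[s,t]` is at most `T₀ + (t-s)/τ` and
`η := b(1 - 1/τ) - a > lam`, then `u` decays exponentially. -/
theorem stmt_8 (t₀ a b T₀ τ c_f lam : ℝ)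
    (hb : 0 < b) (hT₀ : 0 ≤ T₀) (hτ : 1 < τ) (hcf : 0 ≤ c_f) (hlam : 0 ≤ lam)
    (c : ℝ → ℝ) (hc_meas : Measurable c) (hc : ∀ t, c t = 0 ∨ c t = 1)
    (hdur : ∀ s t : ℝ, t₀ ≤ s → s ≤ t → (∫ r in s..t, (1 - c r)) ≤ T₀ + (t - s) / τ)
    (hη : lam < b * (1 - 1 / τ) - a)
    (u u' : ℝ → ℝ) (hu0 : ∀ t ≥ t₀, 0 ≤ u t)
    (hderiv : ∀ t ≥ t₀, HasDerivAt u (u' t) t)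
    (hineq : ∀ t ≥ t₀, u' t ≤ (a - b * c t) * u t + c_f * Real.exp (-lam * (t - t₀))) :
    ∀ t ≥ t₀, u t ≤ Real.exp (b * T₀) *
      (u t₀ * Real.exp (-(b * (1 - 1 / τ) - a) * (t - t₀)) +
        c_f / ((b * (1 - 1 / τ) - a) - lam) * Real.exp (-lam * (t - t₀))) := by
  intro T hT
  have hci (s t : ℝ) : IntervalIntegrable c volume s t :=
    (intervalIntegrable_const (c := (1 : ℝ))).mono_fun hc_meas.aestronglyMeasurable <|
      Filter.Eventually.of_forall fun x => by rcases hc x with h | h <;> simp [h]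
  obtain ⟨M, hM⟩ := isCompact_Icc.bddAbove_image (K := Set.Icc t₀ T) (f := u)
    fun r hr => (hderiv r hr.1).continuousAt.continuousWithinAt
  have hle : ∀ ε ∈ Set.Ioi (0 : ℝ), u T ≤ Real.exp (b * (T₀ + ε)) *
      (u t₀ * Real.exp (-(b * (1 - 1 / τ) - a) * (T - t₀)) +
        c_f / ((b * (1 - 1 / τ) - a) - lam) * Real.exp (-lam * (T - t₀)) + b * M * ε) := by
    intro ε hε
    obtain ⟨d, hd, hcd⟩ := exists_continuous_integral_abs_sub_le hT (hci t₀ T) hε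
    exact switched_le_of_continuous_approx hb hcf hlam hη hci hdur hd hcd hu0 hderiv hineq hT
      fun r hr => hM ⟨r, hr, rfl⟩
  have hlim : ContinuousWithinAt (fun ε : ℝ => Real.exp (b * (T₀ + ε)) *
      (u t₀ * Real.exp (-(b * (1 - 1 / τ) - a) * (T - t₀)) +
        c_f / ((b * (1 - 1 / τ) - a) - lam) * Real.exp (-lam * (T - t₀)) + b * M * ε))
      (Set.Ioi 0) 0 := by
    fun_prop
  simpa using ge_of_tendsto hlim.tendsto (eventually_mem_nhdsWithin.mono hle)
end

section
/- Let A ∈ ℂ^{n×n}, B ∈ ℂ^{n×m}, C ∈ ℂ^{p×n}, S ∈ ℂ^{q×q}, and R ∈ ℂ^{p×q}. Suppose that for every eigenvalue λ of S, the (n+p)×(n+m) block matrix [[A − λI_n, B], [C, 0]] has rank n + p. Then there exist matrices Π ∈ ℂ^{n×q} and Γ ∈ ℂ^{m×q} satisfying the output regulator equations A·Π + B·Γ = Π·S and C·Π = R. -/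
open Matrix

/-- A matrix over a field whose rank is the number of its rows has a right inverse. -/
theorem Matrix.exists_right_inverse_of_rank_eq_card {K r s : Type*} [Field K] [Fintype r]
    [DecidableEq r] [Fintype s] (M : Matrix r s K) (h : M.rank = Fintype.card r) :
    ∃ N : Matrix s r K, M * N = 1 := by
  classical
  rw [← Matrix.mulVec_surjective_iff_exists_right_inverse]
  have htop : LinearMap.range M.mulVecLin = ⊤ := by
    apply Submodule.eq_top_of_finrank_eq
    rw [Module.finrank_fintype_fun_eq_card]
    exact h
  exact LinearMap.range_eq_top.mp htop

/-- The generalized Sylvester equation `M * X - E * X * S = Z` is solvable for every `Z` as soon as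
`M - μ • E` has a right inverse for every `μ` in the spectrum of `S`. -/
theorem Matrix.exists_mul_sub_mul_mul_eq {K r s t : Type*} [Field K] [IsAlgClosed K]
    [Fintype r] [DecidableEq r] [Fintype s] [Fintype t] [DecidableEq t]
    (M E : Matrix r s K) (S : Matrix t t K)
    (h : ∀ μ ∈ spectrum K S, ∃ N : Matrix s r K, (M - μ • E) * N = 1) (Z : Matrix r t K) :
    ∃ X : Matrix s t K, M * X - E * X * S = Z := by
  let mulS : Module.End K (Matrix r t K) :=
    { toFun := fun Y => Y * S
      map_add' := fun Y Y' => Matrix.add_mul Y Y' S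
      map_smul' := fun c Y => Matrix.smul_mul c Y S }
  let T : Matrix s t K →ₗ[K] Matrix r t K :=
    { toFun := fun X => M * X - E * X * S
      map_add' := fun X X' => by
        simp only [Matrix.mul_add, Matrix.add_mul]
        abel
      map_smul' := fun c X => by
        simp only [Matrix.mul_smul, Matrix.smul_mul, RingHom.id_apply, smul_sub] }
  suffices htop : LinearMap.range T = ⊤ from LinearMap.range_eq_top.mp htop Z
  by_contra hne
  let W := (LinearMap.range T).dualAnnihilator
  have hmem (f : Module.Dual K (Matrix r t K)) :
      f ∈ W ↔ ∀ X : Matrix s t K, f (M * X - E * X * S) = 0 := by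
    simp only [W, Submodule.mem_dualAnnihilator, LinearMap.mem_range, forall_exists_index,
      forall_apply_eq_imp_iff]
    rfl
  have hinv : ∀ f ∈ W, mulS.dualMap f ∈ W := by
    intro f hf
    rw [hmem] at hf ⊢
    intro X
    have hX := hf (X * S)
    rwa [← Matrix.mul_assoc, ← Matrix.mul_assoc, ← Matrix.sub_mul] at hX
  have : Nontrivial W := by
    rw [Submodule.nontrivial_iff_ne_bot]
    intro hbot
    exact hne (Subspace.dualAnnihilator_inj.mp (hbot.trans Submodule.dualAnnihilator_top.symm))
  obtain ⟨μ, hμ⟩ := Module.End.exists_eigenvalue (K := K) (V := W)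
    (LinearMap.restrict mulS.dualMap hinv)
  obtain ⟨⟨f, hf⟩, hfe, hf0⟩ := hμ.exists_hasEigenvector
  have hf0 : f ≠ 0 := fun h0 => hf0 (Subtype.ext h0)
  have heig (Y : Matrix r t K) : f (Y * S) = μ * f Y :=
    LinearMap.congr_fun (congrArg Subtype.val (Module.End.mem_eigenspace_iff.mp hfe)) Y
  have hspec : μ ∈ spectrum K S := by
    rw [spectrum.mem_iff]
    rintro ⟨u, hu⟩
    apply hf0
    ext1 Y
    have hY : Y = (Y * (↑u⁻¹ : Matrix t t K)) * (algebraMap K (Matrix t t K) μ - S) := by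
      rw [← hu, Matrix.mul_assoc, Units.inv_mul, Matrix.mul_one]
    rw [hY, Matrix.mul_sub, map_sub, heig, Algebra.algebraMap_eq_smul_one, Matrix.mul_smul,
      Matrix.mul_one, map_smul, smul_eq_mul, sub_self, LinearMap.zero_apply]
  obtain ⟨N, hN⟩ := h μ hspec
  apply hf0
  ext1 Y
  have hY := (hmem f).mp hf (N * Y)
  rw [map_sub, heig, ← smul_eq_mul, ← map_smul, ← map_sub, ← Matrix.smul_mul, ← Matrix.sub_mul,
    ← Matrix.mul_assoc, hN, Matrix.one_mul] at hY
  exact hY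

/-- Solvability of the output regulator equations under the transmission-zero
(rank) condition: if `rank [A - λI, B; C, 0] = n + p` for every eigenvalue `λ` of `S`,
then there exist `Π, Γ` with `AΠ + BΓ = ΠS` and `CΠ = R`. -/
theorem stmt_10 (n m p q : ℕ)
    (A : Matrix (Fin n) (Fin n) ℂ) (B : Matrix (Fin n) (Fin m) ℂ)
    (C : Matrix (Fin p) (Fin n) ℂ) (S : Matrix (Fin q) (Fin q) ℂ)
    (R : Matrix (Fin p) (Fin q) ℂ)
    (hrank : ∀ lam ∈ spectrum ℂ S,
      (Matrix.fromBlocks (A - lam • (1 : Matrix (Fin n) (Fin n) ℂ)) B C 0).rank = n + p) :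
    ∃ (Pi : Matrix (Fin n) (Fin q) ℂ) (Γ : Matrix (Fin m) (Fin q) ℂ),
      A * Pi + B * Γ = Pi * S ∧ C * Pi = R := by
  obtain ⟨X, hX⟩ := Matrix.exists_mul_sub_mul_mul_eq
    (Matrix.fromBlocks A B C (0 : Matrix (Fin p) (Fin m) ℂ)) (Matrix.fromBlocks 1 0 0 0) S
    (fun μ hμ => by
      apply Matrix.exists_right_inverse_of_rank_eq_card
      simpa [Matrix.fromBlocks_smul, Matrix.fromBlocks_neg, Matrix.fromBlocks_add,
        sub_eq_add_neg] using hrank μ hμ)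
    (Matrix.fromRows 0 R)
  rw [← Matrix.fromRows_toRows X, Matrix.fromBlocks_mul_fromRows, Matrix.fromBlocks_mul_fromRows,
    Matrix.fromRows_mul] at hX
  refine ⟨X.toRows₁, X.toRows₂, ?_, ?_⟩
  · ext i j
    rw [← sub_eq_zero]
    simpa using congrFun₂ hX (Sum.inl i) j
  · ext i j
    simpa using congrFun₂ hX (Sum.inr i) j
end
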